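/- The set of irrational real numbers θ with c(θ) > 1 — equivalently, the set of irrational θ for which there exist integers d ≥ 2 and i ≥ 0 such that d divides q_{2j}(θ) for every j ≥ i — has Lebesgue measure zero. -/

import Mathlib

/-- The Gauss–iteration auxiliary sequence of complete quotients of `θ`:
`θ₀ = θ`, `θ_{n+1} = 1 / fract θₙ`. -/
noncomputable def cfAux (θ : ℝ) : ℕ → ℝ
  | 0 => θ
  | n + 1 => (Int.fract (cfAux θ n))⁻¹

/-- The `n`-th partial quotient `aₙ` of the regular continued fraction of `θ`. -/
noncomputable def cfA (θ : ℝ) (n : ℕ) : ℤ := ⌊cfAux θ n⌋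

/-- The numerator `pₙ` of the `n`-th convergent of `θ`:
`p₀ = a₀`, `p₁ = a₁·a₀ + 1`, `pₙ = aₙ·pₙ₋₁ + pₙ₋₂` (so `p₋₁ = 1`). -/
noncomputable def cfP (θ : ℝ) : ℕ → ℤ
  | 0 => cfA θ 0
  | 1 => cfA θ 1 * cfA θ 0 + 1
  | n + 2 => cfA θ (n + 2) * cfP θ (n + 1) + cfP θ n

/-- The denominator `qₙ` of the `n`-th convergent of `θ`:
`q₀ = 1`, `q₁ = a₁`, `qₙ = aₙ·qₙ₋₁ + qₙ₋₂` (so `q₋₁ = 0`). -/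
noncomputable def cfQ (θ : ℝ) : ℕ → ℤ
  | 0 => 1
  | 1 => cfA θ 1
  | n + 2 => cfA θ (n + 2) * cfQ θ (n + 1) + cfQ θ n

open MeasureTheory Set

/-- The map `x ↦ 1 / fract x` sending a complete quotient to the next one. -/
noncomputable def gaussStep (x : ℝ) : ℝ := (Int.fract x)⁻¹

lemma measurable_gaussStep : Measurable gaussStep :=
  measurable_fract.inv

lemma cfAux_eq_iterate (θ : ℝ) (n : ℕ) : cfAux θ n = gaussStep^[n] θ := by
  induction n with
  | zero => rfl
  | succ n ih => rw [Function.iterate_succ_apply', ← ih]; rfl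

lemma eq_floor_add_inv_gaussStep (x : ℝ) : (⌊x⌋ : ℝ) + (gaussStep x)⁻¹ = x := by
  rw [gaussStep, inv_inv, Int.floor_add_fract]

lemma Irrational.fract {x : ℝ} (hx : Irrational x) : Irrational (Int.fract x) := by
  rw [Int.fract]
  exact hx.sub_intCast _

lemma Irrational.gaussStep {x : ℝ} (hx : Irrational x) : Irrational (gaussStep x) :=
  hx.fract.inv

lemma one_lt_gaussStep {x : ℝ} (hx : Irrational x) : 1 < gaussStep x :=
  (one_lt_inv₀ ((Int.fract_nonneg x).lt_of_ne' hx.fract.ne_zero)).2 (Int.fract_lt_one x)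

lemma irrational_cfAux {θ : ℝ} (hθ : Irrational θ) (n : ℕ) : Irrational (cfAux θ n) := by
  induction n with
  | zero => exact hθ
  | succ n ih => exact ih.gaussStep

lemma one_le_cfA_succ {θ : ℝ} (hθ : Irrational θ) (n : ℕ) : 1 ≤ cfA θ (n + 1) := by
  rw [cfA, Int.le_floor, Int.cast_one]
  exact (one_lt_gaussStep (irrational_cfAux hθ n)).le

lemma isCoprime_cfQ_succ (θ : ℝ) (n : ℕ) : IsCoprime (cfQ θ n) (cfQ θ (n + 1)) := by
  induction n with
  | zero => exact isCoprime_one_left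
  | succ n ih =>
    have h : cfQ θ (n + 2) = cfA θ (n + 2) * cfQ θ (n + 1) + cfQ θ n := rfl
    rw [h]
    exact IsCoprime.mul_add_right_right ih.symm _

lemma dvd_cfA_of_dvd_cfQ {θ : ℝ} {d : ℤ} {n : ℕ} (h : d ∣ cfQ θ n) (h' : d ∣ cfQ θ (n + 2)) :
    d ∣ cfA θ (n + 2) := by
  have hq : cfQ θ (n + 2) = cfA θ (n + 2) * cfQ θ (n + 1) + cfQ θ n := rfl
  rw [hq, dvd_add_left h] at h'
  exact ((isCoprime_cfQ_succ θ n).of_isCoprime_of_dvd_left h).dvd_of_dvd_mul_right h'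

lemma volume_preimage_gaussStep_eq_zero {N : Set ℝ} (hN : volume N = 0) :
    volume (gaussStep ⁻¹' N) = 0 := by
  have hsub : gaussStep ⁻¹' N ⊆
      ⋃ n : ℤ, ((fun y : ℝ => (n : ℝ) + y⁻¹) '' (N \ {0}) ∪ {(n : ℝ)}) := by
    intro x hx
    refine mem_iUnion.2 ⟨⌊x⌋, ?_⟩
    by_cases h0 : gaussStep x = 0
    · right
      have := eq_floor_add_inv_gaussStep x
      rw [h0, inv_zero, add_zero] at this
      exact this.symm
    · exact Or.inl ⟨gaussStep x, ⟨hx, h0⟩, eq_floor_add_inv_gaussStep x⟩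
  refine measure_mono_null hsub (measure_iUnion_null fun n => measure_union_null ?_ ?_)
  · refine addHaar_image_eq_zero_of_differentiableOn_of_addHaar_eq_zero volume ?_
      (measure_mono_null sdiff_subset hN)
    intro y hy
    exact ((differentiableAt_inv hy.2).const_add _).differentiableWithinAt
  · exact measure_singleton _

lemma volume_preimage_iterate_gaussStep_eq_zero {N : Set ℝ} (hN : volume N = 0) (k : ℕ) :
    volume (gaussStep^[k] ⁻¹' N) = 0 := by
  induction k with
  | zero => exact hN
  | succ k ih =>
    rw [Function.iterate_succ, preimage_comp]
    exact volume_preimage_gaussStep_eq_zero ih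

/-- The density of the (unnormalised) invariant measure of `gaussStep` on `(1, ∞)`. -/
noncomputable def gaussDensity (x : ℝ) : ℝ := (x * (x + 1))⁻¹

lemma measurable_gaussDensity : Measurable gaussDensity := by
  unfold gaussDensity
  fun_prop

lemma gaussDensity_pos {x : ℝ} (hx : 0 < x) : 0 < gaussDensity x := by
  unfold gaussDensity
  positivity

/-- Telescoping bound for the transfer operator of `gaussStep` restricted to branches `n ≥ k`. -/
lemma sum_transfer_gaussDensity_le {y : ℝ} (hy : 1 < y) {k : ℕ} (N : ℕ) :
    ∑ n ∈ Finset.range N, (y ^ 2)⁻¹ * gaussDensity ((k + n : ℕ) + y⁻¹) ≤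
      (y * (k * y + 1))⁻¹ := by
  have hy0 : 0 < y := by linarith
  have key : ∑ n ∈ Finset.range N, (y ^ 2)⁻¹ * gaussDensity ((k + n : ℕ) + y⁻¹) =
      (y * (k * y + 1))⁻¹ - (y * ((k + N : ℕ) * y + 1))⁻¹ := by
    induction N with
    | zero => simp
    | succ N ih =>
      rw [Finset.sum_range_succ, ih, gaussDensity]
      push_cast
      have h1 : (0 : ℝ) < (k + N) * y + 1 := by positivity
      have h2 : (0 : ℝ) < (k + (N + 1)) * y + 1 := by positivity
      have h3 : (0 : ℝ) < k * y + 1 := by positivity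
      have e1 : (k + N : ℝ) + y⁻¹ = ((k + N) * y + 1) / y := by field_simp
      have e2 : ((k + N) * y + 1) / y + 1 = ((k + (N + 1)) * y + 1) / y := by field_simp; ring
      rw [e1, e2]
      field_simp
      ring
  rw [key]
  have : 0 ≤ (y * ((k + N : ℕ) * y + 1))⁻¹ := by positivity
  linarith

lemma setLIntegral_image_branch {A : Set ℝ} (hA : MeasurableSet A) (hA1 : A ⊆ Ioi 1) (n : ℕ) :
    ∫⁻ x in (fun y : ℝ => (n : ℝ) + y⁻¹) '' A, ENNReal.ofReal (gaussDensity x) =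
      ∫⁻ y in A, ENNReal.ofReal ((y ^ 2)⁻¹ * gaussDensity (n + y⁻¹)) := by
  rw [lintegral_image_eq_lintegral_abs_deriv_mul hA (f' := fun y => -(y ^ 2)⁻¹)]
  · refine setLIntegral_congr_fun hA fun y _ => ?_
    rw [← ENNReal.ofReal_mul (abs_nonneg _), abs_neg, abs_of_nonneg (by positivity)]
  · intro y hy
    have : y ≠ 0 := (zero_lt_one.trans (hA1 hy)).ne'
    exact ((hasDerivAt_inv this).const_add _).hasDerivWithinAt
  · intro a _ b _ h
    simpa using h

lemma setLIntegral_gaussDensity_le {A B : Set ℝ} (hA : MeasurableSet A) (hA1 : A ⊆ Ioi 1) {k : ℕ}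
    (hB : ∀ x ∈ B, (k : ℝ) ≤ x ∧ gaussStep x ∈ A) :
    ∫⁻ x in B, ENNReal.ofReal (gaussDensity x) ≤
      ∫⁻ y in A, ENNReal.ofReal (y * (k * y + 1))⁻¹ := by
  have hsub : B ⊆ ⋃ n : ℕ, (fun y : ℝ => ((k + n : ℕ) : ℝ) + y⁻¹) '' A := by
    intro x hx
    obtain ⟨hk, hxA⟩ := hB x hx
    have hfl : (k : ℤ) ≤ ⌊x⌋ := Int.le_floor.2 (by exact_mod_cast hk)
    obtain ⟨n, hn⟩ := Int.le.dest hfl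
    refine mem_iUnion.2 ⟨n, gaussStep x, hxA, ?_⟩
    have h := eq_floor_add_inv_gaussStep x
    rw [← hn] at h
    exact_mod_cast h
  calc ∫⁻ x in B, ENNReal.ofReal (gaussDensity x)
      ≤ ∫⁻ x in ⋃ n : ℕ, (fun y : ℝ => ((k + n : ℕ) : ℝ) + y⁻¹) '' A,
          ENNReal.ofReal (gaussDensity x) := lintegral_mono_set hsub
    _ ≤ ∑' n : ℕ, ∫⁻ x in (fun y : ℝ => ((k + n : ℕ) : ℝ) + y⁻¹) '' A,
          ENNReal.ofReal (gaussDensity x) := lintegral_iUnion_le _ _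
    _ = ∑' n : ℕ, ∫⁻ y in A, ENNReal.ofReal ((y ^ 2)⁻¹ * gaussDensity ((k + n : ℕ) + y⁻¹)) :=
        tsum_congr fun n => setLIntegral_image_branch hA hA1 _
    _ = ∫⁻ y in A, ∑' n : ℕ, ENNReal.ofReal ((y ^ 2)⁻¹ * gaussDensity ((k + n : ℕ) + y⁻¹)) := by
        refine (lintegral_tsum fun n => Measurable.aemeasurable ?_).symm
        have := measurable_gaussDensity
        fun_prop
    _ ≤ ∫⁻ y in A, ENNReal.ofReal (y * (k * y + 1))⁻¹ := by
        refine setLIntegral_mono' hA fun y hy => ENNReal.tsum_le_of_sum_range_le fun N => ?_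
        have hy0 : 0 < y := zero_lt_one.trans (hA1 hy)
        rw [← ENNReal.ofReal_sum_of_nonneg]
        · exact ENNReal.ofReal_le_ofReal (sum_transfer_gaussDensity_le (hA1 hy) N)
        · intro n _
          have := gaussDensity_pos (x := (k + n : ℕ) + y⁻¹) (by positivity)
          positivity

/-- The points all of whose partial quotients of even index are at least `2`. -/
def evenLarge : Set ℝ :=
  {x | ∀ j : ℕ, 2 ≤ gaussStep^[2 * j] x ∧ 1 < gaussStep^[2 * j + 1] x}

lemma measurableSet_evenLarge : MeasurableSet evenLarge := by
  have h : evenLarge = ⋂ j : ℕ, (gaussStep^[2 * j] ⁻¹' Ici 2) ∩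
      (gaussStep^[2 * j + 1] ⁻¹' Ioi 1) := by
    ext x
    simp [evenLarge]
  rw [h]
  exact MeasurableSet.iInter fun j =>
    (measurable_gaussStep.iterate _ measurableSet_Ici).inter
      (measurable_gaussStep.iterate _ measurableSet_Ioi)

lemma two_le_of_mem_evenLarge {x : ℝ} (hx : x ∈ evenLarge) : 2 ≤ x := (hx 0).1

lemma one_lt_gaussStep_of_mem_evenLarge {x : ℝ} (hx : x ∈ evenLarge) : 1 < gaussStep x := (hx 0).2

lemma gaussStep_gaussStep_mem_evenLarge {x : ℝ} (hx : x ∈ evenLarge) :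
    gaussStep (gaussStep x) ∈ evenLarge := fun j => hx (j + 1)

lemma setLIntegral_gaussDensity_evenLarge_ne_top :
    ∫⁻ x in evenLarge, ENNReal.ofReal (gaussDensity x) ≠ ⊤ := by
  have hint : IntegrableOn (fun x : ℝ => x ^ (-2 : ℝ)) (Ioi 1) :=
    integrableOn_Ioi_rpow_of_lt (by norm_num) one_pos
  refine ne_top_of_le_ne_top hint.setLIntegral_lt_top.ne
    ((lintegral_mono_set fun x hx => ?_).trans
      (setLIntegral_mono' measurableSet_Ioi fun x hx => ENNReal.ofReal_le_ofReal ?_))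
  · have := two_le_of_mem_evenLarge hx
    exact mem_Ioi.2 (by linarith)
  · have hx0 : (0 : ℝ) < x := zero_lt_one.trans hx
    rw [Real.rpow_neg hx0.le, Real.rpow_two, gaussDensity]
    gcongr
    nlinarith

lemma setLIntegral_gaussDensity_evenLarge_eq_zero :
    ∫⁻ x in evenLarge, ENNReal.ofReal (gaussDensity x) = 0 := by
  set E := evenLarge
  set E' : Set ℝ := Ioi 1 ∩ gaussStep ⁻¹' E
  have hE' : MeasurableSet E' :=
    measurableSet_Ioi.inter (measurable_gaussStep measurableSet_evenLarge)
  have h1 : ∫⁻ x in E', ENNReal.ofReal (gaussDensity x) ≤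
      ∫⁻ x in E, ENNReal.ofReal (gaussDensity x) := by
    refine (setLIntegral_gaussDensity_le (k := 1) measurableSet_evenLarge
      (fun x hx => ?_) fun x hx => ⟨?_, hx.2⟩).trans_eq ?_
    · have := two_le_of_mem_evenLarge hx
      exact mem_Ioi.2 (by linarith)
    · simpa using (mem_Ioi.1 hx.1).le
    · simp [gaussDensity, E]
  have h2 : ∫⁻ x in E, ENNReal.ofReal (gaussDensity x) ≤
      ENNReal.ofReal (2 / 3) * ∫⁻ x in E', ENNReal.ofReal (gaussDensity x) := by
    refine (setLIntegral_gaussDensity_le (k := 2) hE' inter_subset_left fun x hx =>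
      ⟨by simpa using two_le_of_mem_evenLarge hx, one_lt_gaussStep_of_mem_evenLarge hx,
        gaussStep_gaussStep_mem_evenLarge hx⟩).trans ?_
    rw [← lintegral_const_mul' _ _ ENNReal.ofReal_ne_top]
    refine setLIntegral_mono' hE' fun y hy => ?_
    have hy1 : (1 : ℝ) < y := hy.1
    rw [← ENNReal.ofReal_mul (by norm_num)]
    refine ENNReal.ofReal_le_ofReal ?_
    rw [gaussDensity, ← div_eq_mul_inv, ← one_div, div_le_div_iff₀ (by positivity) (by positivity)]
    push_cast
    nlinarith
  have h3 := h2.trans (mul_le_mul_right h1 _)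
  have hfin : ∫⁻ x in E, ENNReal.ofReal (gaussDensity x) ≠ ⊤ :=
    setLIntegral_gaussDensity_evenLarge_ne_top
  rw [← ENNReal.toReal_le_toReal hfin (ENNReal.mul_ne_top ENNReal.ofReal_ne_top hfin),
    ENNReal.toReal_mul, ENNReal.toReal_ofReal (by norm_num)] at h3
  refine ((ENNReal.toReal_eq_zero_iff _).1 ?_).resolve_right hfin
  linarith [ENNReal.toReal_nonneg (a := ∫⁻ x in E, ENNReal.ofReal (gaussDensity x))]

lemma volume_evenLarge : volume evenLarge = 0 := by
  by_contra h
  refine (setLIntegral_pos_iff (measurable_gaussDensity.ennreal_ofReal) (s := evenLarge)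
    (μ := volume)).2 ?_ |>.ne' setLIntegral_gaussDensity_evenLarge_eq_zero
  rw [inter_eq_right.2]
  · exact pos_iff_ne_zero.2 h
  · intro x hx
    have := two_le_of_mem_evenLarge hx
    exact (ENNReal.ofReal_pos.2 (gaussDensity_pos (by linarith))).ne'

/-- The set of irrational real numbers `θ` with `c(θ) > 1` — equivalently,
the set of irrational `θ` for which there exist integers `d ≥ 2` and `i ≥ 0` such that `d`
divides `q_{2j}(θ)` for every `j ≥ i` — has Lebesgue measure zero. -/
theorem stmt_2 :
    MeasureTheory.volume
      {θ : ℝ | Irrational θ ∧ ∃ d : ℤ, 2 ≤ d ∧ ∃ i : ℕ, ∀ j : ℕ, i ≤ j → d ∣ cfQ θ (2 * j)}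
      = 0 := by
  refine measure_mono_null (t := ⋃ i : ℕ, gaussStep^[2 * i + 2] ⁻¹' evenLarge) ?_
    (measure_iUnion_null fun i => volume_preimage_iterate_gaussStep_eq_zero volume_evenLarge _)
  rintro θ ⟨hθ, d, hd, i, hi⟩
  refine mem_iUnion.2 ⟨i, fun j => ?_⟩
  rw [← Function.iterate_add_apply, ← Function.iterate_add_apply, ← cfAux_eq_iterate,
    ← cfAux_eq_iterate]
  constructor
  · have hdvd : d ∣ cfA θ (2 * (i + j) + 2) :=
      dvd_cfA_of_dvd_cfQ (hi (i + j) (by omega)) (hi (i + j + 1) (by omega))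
    have h2 : 2 ≤ cfA θ (2 * (i + j) + 2) :=
      hd.trans (Int.le_of_dvd (one_le_cfA_succ hθ (2 * (i + j) + 1)) hdvd)
    rw [cfA, Int.le_floor] at h2
    rw [show 2 * j + (2 * i + 2) = 2 * (i + j) + 2 by ring]
    exact_mod_cast h2
  · rw [show 2 * j + 1 + (2 * i + 2) = 2 * (i + j) + 2 + 1 by ring]
    exact one_lt_gaussStep (irrational_cfAux hθ _)
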